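/- Let P₁, P₂, U ⊆ ℝ² be compact convex lattice polygons, i.e. convex hulls of nonempty finite subsets of ℤ². Then |(U+P₁+P₂) ∩ ℤ²| − |(U+P₁) ∩ ℤ²| − |(U+P₂) ∩ ℤ²| + |U ∩ ℤ²| = vol(P₁+P₂) − vol(P₁) − vol(P₂), where vol is Lebesgue measure and + denotes Minkowski sum. -/

import Mathlib

open Pointwise MeasureTheory

/-- The number of lattice points of a set `P ⊆ ℝ²`. -/
noncomputable def latticeCount (P : Set (Fin 2 → ℝ)) : ℕ :=
  Set.ncard {a : Fin 2 → ℤ | (fun i => (a i : ℝ)) ∈ P}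

/-- The inclusion `ℤ² → ℝ²`. -/
def latticeEmb : (Fin 2 → ℤ) →+ (Fin 2 → ℝ) where
  toFun a i := (a i : ℝ)
  map_zero' := by ext; simp
  map_add' a b := by ext; simp

@[simp]
theorem latticeEmb_apply (a : Fin 2 → ℤ) (i : Fin 2) : latticeEmb a i = (a i : ℝ) := rfl

theorem latticeEmb_injective : Function.Injective latticeEmb := fun a b h => by
  ext i
  exact Int.cast_injective (congrFun h i : (a i : ℝ) = b i)

theorem latticeCount_eq_ncard_preimage (P : Set (Fin 2 → ℝ)) :
    latticeCount P = (latticeEmb ⁻¹' P).ncard := rfl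

/-- A lattice polygon is the convex hull of a nonempty finite set of lattice points. -/
def IsLatticePolygon (P : Set (Fin 2 → ℝ)) : Prop :=
  ∃ V : Finset (Fin 2 → ℤ), V.Nonempty ∧ P = convexHull ℝ (latticeEmb '' V)

namespace IsLatticePolygon

variable {P Q : Set (Fin 2 → ℝ)}

theorem convex (hP : IsLatticePolygon P) : Convex ℝ P := by
  obtain ⟨V, -, rfl⟩ := hP
  exact convex_convexHull ℝ _

theorem isCompact (hP : IsLatticePolygon P) : IsCompact P := by
  obtain ⟨V, -, rfl⟩ := hP
  exact (V.finite_toSet.image _).isCompact_convexHull ℝ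

theorem nonempty (hP : IsLatticePolygon P) : P.Nonempty := by
  obtain ⟨V, hV, rfl⟩ := hP
  exact (hV.to_set.image _).convexHull

theorem add (hP : IsLatticePolygon P) (hQ : IsLatticePolygon Q) : IsLatticePolygon (P + Q) := by
  classical
  obtain ⟨V, hV, rfl⟩ := hP
  obtain ⟨W, hW, rfl⟩ := hQ
  exact ⟨V + W, hV.add hW, by rw [Finset.coe_add, Set.image_add, convexHull_add]⟩

theorem neg (hP : IsLatticePolygon P) : IsLatticePolygon (-P) := by
  classical
  obtain ⟨V, hV, rfl⟩ := hP
  refine ⟨-V, hV.neg, ?_⟩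
  rw [← convexHull_neg, Finset.coe_neg, ← Set.image_neg_eq_neg, ← Set.image_neg_eq_neg,
    Set.image_image, Set.image_image]
  simp only [map_neg]

theorem singleton (p : Fin 2 → ℤ) : IsLatticePolygon {latticeEmb p} :=
  ⟨{p}, by simp, by simp⟩

theorem segment (p q : Fin 2 → ℤ) :
    IsLatticePolygon (segment ℝ (latticeEmb p) (latticeEmb q)) := by
  classical
  exact ⟨{p, q}, by simp, by simp [Set.image_insert_eq, convexHull_pair]⟩

theorem finite_preimage (hP : IsLatticePolygon P) : (latticeEmb ⁻¹' P).Finite := by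
  obtain ⟨R, hR⟩ := hP.isCompact.isBounded.subset_closedBall 0
  refine (Set.finite_Icc (fun _ : Fin 2 => -⌈R⌉) (fun _ => ⌈R⌉)).subset fun a ha => ?_
  have h (i : Fin 2) : |(a i : ℝ)| ≤ R := by
    have := mem_closedBall_zero_iff.1 (hR ha)
    exact (norm_le_pi_norm (latticeEmb a) i).trans this
  have h' (i : Fin 2) : |a i| ≤ ⌈R⌉ := by
    have : ((|a i| : ℤ) : ℝ) ≤ ⌈R⌉ := by
      push_cast
      exact (h i).trans (Int.le_ceil R)
    exact_mod_cast this
  exact ⟨fun i => (abs_le.1 (h' i)).1, fun i => (abs_le.1 (h' i)).2⟩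

/-- Every finite set of generators of a lattice polygon contains a set of generators consisting of
extreme points. -/
theorem exists_subset_extremePoints (V : Finset (Fin 2 → ℤ)) :
    ∃ W ⊆ V, convexHull ℝ (latticeEmb '' W) = convexHull ℝ (latticeEmb '' V) ∧
      latticeEmb '' W ⊆ (convexHull ℝ (latticeEmb '' V)).extremePoints ℝ := by
  classical
  set E := (convexHull ℝ (latticeEmb '' (V : Set (Fin 2 → ℤ)))).extremePoints ℝ
  have himage : latticeEmb '' ({a ∈ V | latticeEmb a ∈ E} : Finset _) = E := by
    ext x
    constructor
    · rintro ⟨a, ha, rfl⟩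
      exact (Finset.mem_filter.1 ha).2
    · intro hx
      obtain ⟨a, ha, rfl⟩ := extremePoints_convexHull_subset hx
      exact ⟨a, Finset.mem_filter.2 ⟨ha, hx⟩, rfl⟩
  have hfin : (latticeEmb '' (V : Set (Fin 2 → ℤ))).Finite := V.finite_toSet.image _
  refine ⟨{a ∈ V | latticeEmb a ∈ E}, Finset.filter_subset _ _, ?_, himage.subset⟩
  rw [himage, ← closure_convexHull_extremePoints (hfin.isCompact_convexHull ℝ)
    (convex_convexHull ℝ _)]
  exact ((hfin.subset extremePoints_convexHull_subset).isClosed_convexHull ℝ).closure_eq.symm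

end IsLatticePolygon

theorem latticeCount_neg (P : Set (Fin 2 → ℝ)) : latticeCount (-P) = latticeCount P := by
  simp only [latticeCount_eq_ncard_preimage]
  rw [← Set.ncard_image_of_injective (latticeEmb ⁻¹' P) neg_injective, Set.image_neg_eq_neg]
  congr 1
  ext a
  simp

theorem latticeCount_add_singleton (P : Set (Fin 2 → ℝ)) (p : Fin 2 → ℤ) :
    latticeCount (P + {latticeEmb p}) = latticeCount P := by
  simp only [latticeCount_eq_ncard_preimage]
  rw [← Set.ncard_image_of_injective (latticeEmb ⁻¹' P) (add_left_injective p)]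
  congr 1
  ext a
  simp only [Set.add_singleton, Set.mem_preimage, Set.mem_image]
  constructor
  · rintro ⟨x, hx, h⟩
    refine ⟨a - p, ?_, by simp⟩
    rwa [map_sub, ← h, add_sub_cancel_right]
  · rintro ⟨b, hb, rfl⟩
    exact ⟨_, hb, by simp⟩

theorem latticeCount_zero : latticeCount {0} = 1 := by
  have : latticeEmb ⁻¹' {0} = {0} := by
    ext a
    simpa using map_eq_zero_iff latticeEmb latticeEmb_injective
  rw [latticeCount_eq_ncard_preimage, this, Set.ncard_singleton]

theorem latticeCount_union_add_inter {P Q : Set (Fin 2 → ℝ)} (hP : IsLatticePolygon P)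
    (hQ : IsLatticePolygon Q) :
    latticeCount (P ∪ Q) + latticeCount (P ∩ Q) = latticeCount P + latticeCount Q :=
  Set.ncard_union_add_ncard_inter _ _ hP.finite_preimage hQ.finite_preimage

/-- If two closed convex sets have convex union, then their intersection is compatible with
Minkowski addition of a convex set. -/
theorem inter_add_of_convex_union {E : Type*} [AddCommGroup E] [Module ℝ E] [TopologicalSpace E]
    [IsTopologicalAddGroup E] [ContinuousSMul ℝ E]
    {P Q K : Set E} (hP : IsClosed P) (hQ : IsClosed Q) (hPQ : Convex ℝ (P ∪ Q))
    (hK : Convex ℝ K) : P ∩ Q + K = (P + K) ∩ (Q + K) := by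
  refine (Set.inter_add_subset).antisymm ?_
  rintro _ ⟨⟨p, hp, k, hk, rfl⟩, ⟨q, hq, k', hk', h⟩⟩
  let f : ℝ → E := fun t => AffineMap.lineMap p q t
  have hf : Continuous f := AffineMap.lineMap_continuous
  have hsub : Set.Icc (0 : ℝ) 1 ⊆ f ⁻¹' P ∪ f ⁻¹' Q := fun t ht =>
    hPQ.lineMap_mem (Or.inl hp) (Or.inr hq) ht
  obtain ⟨t, ht, htP, htQ⟩ := isPreconnected_closed_iff.1 isPreconnected_Icc _ _
    (hP.preimage hf) (hQ.preimage hf) hsub ⟨0, by simp, by simpa [f] using hp⟩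
    ⟨1, by simp, by simpa [f] using hq⟩
  refine ⟨f t, ⟨htP, htQ⟩, _, hK.lineMap_mem hk hk' ht, ?_⟩
  obtain rfl : k' = p + k - q := eq_sub_of_add_eq' h
  simp only [f, AffineMap.lineMap_apply_module]
  module

/-- The linear form `x ↦ v₀ x₁ - v₁ x₀` on `ℝ²`, whose level sets are the lines parallel to `v`. -/
def levelForm (v : Fin 2 → ℤ) : (Fin 2 → ℝ) →ₗ[ℝ] ℝ :=
  (v 0 : ℝ) • LinearMap.proj 1 - (v 1 : ℝ) • LinearMap.proj 0

theorem levelForm_apply (v : Fin 2 → ℤ) (x : Fin 2 → ℝ) :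
    levelForm v x = v 0 * x 1 - v 1 * x 0 := rfl

theorem levelForm_latticeEmb_self (v : Fin 2 → ℤ) : levelForm v (latticeEmb v) = 0 := by
  simp [levelForm_apply, mul_comm]

theorem levelForm_latticeEmb (v a : Fin 2 → ℤ) :
    levelForm v (latticeEmb a) = ((v 0 * a 1 - v 1 * a 0 : ℤ) : ℝ) := by
  simp [levelForm_apply]

/-- Two points of `ℝ²` on the same line parallel to a primitive vector `v` differ by an explicit
multiple of `v`, which is integral for lattice points. -/
theorem eq_add_smul_of_levelForm_eq {v : Fin 2 → ℤ} {r s : ℤ} (hrs : r * v 0 + s * v 1 = 1)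
    {x z : Fin 2 → ℝ} (h : levelForm v x = levelForm v z) :
    x = z + ((r : ℝ) * (x 0 - z 0) + s * (x 1 - z 1)) • latticeEmb v := by
  have hrs' : (r : ℝ) * v 0 + s * v 1 = 1 := by exact_mod_cast hrs
  rw [levelForm_apply, levelForm_apply] at h
  ext i
  fin_cases i
  · simp
    linear_combination (z 0 - x 0) * hrs' - (s : ℝ) * h
  · simp
    linear_combination (z 1 - x 1) * hrs' + (r : ℝ) * h

/-- Adding the primitive segment `[0, v]` to a lattice polygon `X` adds one lattice point on
each lattice line parallel to `v` which meets `X`. -/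
theorem latticeCount_add_segment {v : Fin 2 → ℤ} (hv : IsCoprime (v 0) (v 1))
    {X : Set (Fin 2 → ℝ)} (hX : IsLatticePolygon X) :
    latticeCount (X + segment ℝ 0 (latticeEmb v)) =
      latticeCount X + ((fun c : ℤ => (c : ℝ)) ⁻¹' (levelForm v '' X)).ncard := by
  obtain ⟨r, s, hrs⟩ := hv
  set S := segment ℝ 0 (latticeEmb v) with hS
  have hXS : IsLatticePolygon (X + S) := by
    have := IsLatticePolygon.segment 0 v
    rw [map_zero] at this
    exact hX.add this
  have mem_S {x : Fin 2 → ℝ} : x ∈ S ↔ ∃ t ∈ Set.Icc (0 : ℝ) 1, t • latticeEmb v = x := by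
    simp [hS, segment_eq_image]
  have hsub : latticeEmb ⁻¹' X ⊆ latticeEmb ⁻¹' (X + S) := fun a ha =>
    ⟨_, ha, 0, left_mem_segment ℝ _ _, add_zero _⟩
  simp only [latticeCount_eq_ncard_preimage]
  rw [← Set.ncard_sdiff_add_ncard_of_subset hsub hXS.finite_preimage, add_comm]
  congr 1
  have add_mem_iff (y : Fin 2 → ℝ) : y ∈ X + S ↔ ∃ t ∈ Set.Icc (0 : ℝ) 1,
      y - t • latticeEmb v ∈ X := by
    constructor
    · rintro ⟨x, hx, _, h, rfl⟩
      obtain ⟨t, ht, rfl⟩ := mem_S.1 h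
      exact ⟨t, ht, by simpa using hx⟩
    · rintro ⟨t, ht, h⟩
      exact ⟨_, h, _, mem_S.2 ⟨t, ht, rfl⟩, by simp⟩
  -- on each line parallel to `v`, a lattice point entering `X + S` is unique
  have key {y : Fin 2 → ℝ} (hy : y ∈ X + S) (hyX : y ∉ X) {m : ℝ} (hm : 1 ≤ m)
      (hym : y + m • latticeEmb v ∈ X + S) : False := by
    obtain ⟨t, ht, hyt⟩ := (add_mem_iff _).1 hy
    obtain ⟨t', ht', hyt'⟩ := (add_mem_iff _).1 hym
    refine hyX (hX.convex.segment_subset hyt hyt' ?_)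
    rcases eq_or_lt_of_le (show 0 ≤ m - t' + t by linarith [ht.1, ht'.2]) with h0 | h0
    · have h1 : t = 0 := by linarith [ht.1, ht'.2]
      rw [h1]
      simpa using left_mem_segment ℝ y _
    · refine ⟨(m - t') / (m - t' + t), t / (m - t' + t), div_nonneg (by linarith [ht'.2]) h0.le,
        div_nonneg ht.1 h0.le, by field_simp, ?_⟩
      ext i
      simp
      field_simp
      ring
  rw [← Set.InjOn.ncard_image (f := fun a : Fin 2 → ℤ => v 0 * a 1 - v 1 * a 0)]
  · congr 1
    ext c
    constructor
    · rintro ⟨a, ⟨ha, -⟩, rfl⟩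
      obtain ⟨t, -, h⟩ := (add_mem_iff _).1 ha
      refine ⟨_, h, ?_⟩
      rw [map_sub, map_smul, levelForm_latticeEmb_self, smul_zero, sub_zero, levelForm_latticeEmb]
    · rintro ⟨x, hx, hxc⟩
      let z : Fin 2 → ℤ := ![-s * c, r * c]
      have hz : v 0 * z 1 - v 1 * z 0 = c := by
        simp only [z, Matrix.cons_val_zero, Matrix.cons_val_one]
        linear_combination c * hrs
      have hxz : levelForm v x = levelForm v (latticeEmb z) := by
        rw [levelForm_latticeEmb, hz, hxc]
      let T : Set ℝ := (fun t : ℝ => latticeEmb z + t • latticeEmb v) ⁻¹' X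
      have hTne : T.Nonempty :=
        ⟨_, (eq_add_smul_of_levelForm_eq hrs hxz ▸ hx :)⟩
      have hv0 : latticeEmb v ≠ 0 := by
        intro h
        rw [map_eq_zero_iff latticeEmb latticeEmb_injective] at h
        simp [h] at hrs
      have hTc : IsCompact T := by
        refine Topology.IsClosedEmbedding.isCompact_preimage ?_ hX.isCompact
        exact (Homeomorph.addLeft (latticeEmb z)).isClosedEmbedding.comp
          (isClosedEmbedding_smul_left hv0)
      obtain ⟨β, hβ, hmax⟩ := hTc.exists_isGreatest hTne
      have hn1 := Int.floor_le β
      have hn2 := Int.lt_floor_add_one β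
      have hcast : latticeEmb (z + (⌊β⌋ + 1) • v) =
          latticeEmb z + ((⌊β⌋ : ℝ) + 1) • latticeEmb v := by
        ext i
        simp
      refine ⟨z + (⌊β⌋ + 1) • v, ⟨?_, fun h => ?_⟩, ?_⟩
      · rw [Set.mem_preimage, add_mem_iff]
        refine ⟨⌊β⌋ + 1 - β, ⟨by linarith, by linarith⟩, ?_⟩
        rw [hcast]
        have : latticeEmb z + β • latticeEmb v ∈ X := hβ
        convert this using 1
        module
      · rw [Set.mem_preimage, hcast] at h
        linarith [hmax h]
      · simp only [Pi.add_apply, Pi.smul_apply, smul_eq_mul]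
        linear_combination hz
  · intro a ha b hb hab
    have hab' : levelForm v (latticeEmb a) = levelForm v (latticeEmb b) := by
      rw [levelForm_latticeEmb, levelForm_latticeEmb]
      exact_mod_cast hab
    have h1 := eq_add_smul_of_levelForm_eq hrs hab'
    have h2 := eq_add_smul_of_levelForm_eq hrs hab'.symm
    obtain ⟨m, hm⟩ : ∃ m : ℤ, m = r * (a 0 - b 0) + s * (a 1 - b 1) := ⟨_, rfl⟩
    have hm1 : (r : ℝ) * (latticeEmb a 0 - latticeEmb b 0) +
        s * (latticeEmb a 1 - latticeEmb b 1) = m := by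
      rw [hm]
      simp
    have hm2 : (r : ℝ) * (latticeEmb b 0 - latticeEmb a 0) +
        s * (latticeEmb b 1 - latticeEmb a 1) = -m := by
      rw [← hm1]
      ring
    rw [hm1] at h1
    rw [hm2] at h2
    rcases lt_trichotomy m 0 with h | h | h
    · refine (key ha.1 ha.2 (m := -m) ?_ (h2 ▸ hb.1)).elim
      have : (m : ℝ) ≤ -1 := by exact_mod_cast (by lia : m ≤ -1)
      linarith
    · rw [h] at h1
      exact latticeEmb_injective (by simpa using h1)
    · refine (key hb.1 hb.2 (m := m) ?_ (h1 ▸ ha.1)).elim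
      exact_mod_cast h

/-- The image of a lattice polygon under an integral linear form is an interval with integral
end points. -/
theorem IsLatticePolygon.exists_levelForm_image_eq_Icc {X : Set (Fin 2 → ℝ)}
    (hX : IsLatticePolygon X) (v : Fin 2 → ℤ) :
    ∃ m M : ℤ, m ≤ M ∧ levelForm v '' X = Set.Icc (m : ℝ) M := by
  obtain ⟨V, hV, rfl⟩ := hX
  let W : Finset ℤ := V.image fun a => v 0 * a 1 - v 1 * a 0
  have hW : W.Nonempty := hV.image _
  refine ⟨W.min' hW, W.max' hW, W.min'_le_max' hW, ?_⟩
  have himage : levelForm v '' (latticeEmb '' V) = (fun c : ℤ => (c : ℝ)) '' W := by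
    simp only [W, Finset.coe_image, Set.image_image, levelForm_latticeEmb]
  rw [LinearMap.image_convexHull, himage]
  apply Set.Subset.antisymm
  · refine convexHull_min ?_ (convex_Icc _ _)
    rintro _ ⟨c, hc, rfl⟩
    exact ⟨Int.cast_le.2 (W.min'_le c hc), Int.cast_le.2 (W.le_max' c hc)⟩
  · rw [← segment_eq_Icc (Int.cast_le.2 (W.min'_le_max' hW))]
    exact (convex_convexHull ℝ _).segment_subset
      (subset_convexHull ℝ _ ⟨_, W.min'_mem hW, rfl⟩)
      (subset_convexHull ℝ _ ⟨_, W.max'_mem hW, rfl⟩)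

/-- The number of integral levels of an integral linear form is additive up to a constant. -/
theorem ncard_levels_add {X Y : Set (Fin 2 → ℝ)} (hX : IsLatticePolygon X)
    (hY : IsLatticePolygon Y) (v : Fin 2 → ℤ) :
    ((fun c : ℤ => (c : ℝ)) ⁻¹' (levelForm v '' (X + Y))).ncard + 1 =
      ((fun c : ℤ => (c : ℝ)) ⁻¹' (levelForm v '' X)).ncard +
        ((fun c : ℤ => (c : ℝ)) ⁻¹' (levelForm v '' Y)).ncard := by
  obtain ⟨m, M, hm, hXm⟩ := hX.exists_levelForm_image_eq_Icc v
  obtain ⟨k, K, hk, hYk⟩ := hY.exists_levelForm_image_eq_Icc v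
  have hadd : Set.Icc (m : ℝ) M + Set.Icc (k : ℝ) K =
      Set.Icc ((m + k : ℤ) : ℝ) ((M + K : ℤ) : ℝ) := by
    push_cast
    refine (Set.Icc_add_Icc_subset _ _ _ _).antisymm ?_
    rw [← segment_eq_Icc (by exact_mod_cast add_le_add hm hk)]
    exact ((convex_Icc _ _).add (convex_Icc _ _)).segment_subset
      (Set.add_mem_add (Set.left_mem_Icc.2 (Int.cast_le.2 hm))
        (Set.left_mem_Icc.2 (Int.cast_le.2 hk)))
      (Set.add_mem_add (Set.right_mem_Icc.2 (Int.cast_le.2 hm))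
        (Set.right_mem_Icc.2 (Int.cast_le.2 hk)))
  have hcast (a b : ℤ) : (fun c : ℤ => (c : ℝ)) ⁻¹' Set.Icc (a : ℝ) b = Set.Icc a b :=
    Int.preimage_Icc.trans (by simp)
  rw [Set.image_add, hXm, hYk, hadd, hcast, hcast, hcast]
  simp only [← Finset.coe_Icc, Set.ncard_coe_finset, Int.card_Icc]
  lia

/-- Adding `S` to a lattice polygon changes the lattice point count by a quantity which is additive
up to a constant. -/
def HasAffineGrowth (S : Set (Fin 2 → ℝ)) : Prop :=
  ∃ (w : Set (Fin 2 → ℝ) → ℝ) (k : ℝ),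
    (∀ X, IsLatticePolygon X → (latticeCount (X + S) : ℝ) = latticeCount X + w X) ∧
    ∀ X Y, IsLatticePolygon X → IsLatticePolygon Y → w (X + Y) = w X + w Y - k

namespace HasAffineGrowth

variable {S T : Set (Fin 2 → ℝ)}

theorem add (hS : HasAffineGrowth S) (hT : HasAffineGrowth T) (hS' : IsLatticePolygon S) :
    HasAffineGrowth (S + T) := by
  obtain ⟨w, k, hw, hw'⟩ := hS
  obtain ⟨u, l, hu, hu'⟩ := hT
  refine ⟨fun X => w X + (u X + (u S - l)), k + u S, fun X hX => ?_, fun X Y hX hY => ?_⟩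
  · rw [← add_assoc, hu _ (hX.add hS'), hw X hX, hu' X S hX hS']
    ring
  · simp only [hw' X Y hX hY, hu' X Y hX hY]
    ring

theorem singleton (p : Fin 2 → ℤ) : HasAffineGrowth {latticeEmb p} :=
  ⟨0, 0, fun X _ => by rw [latticeCount_add_singleton]; simp, by simp⟩

theorem primitive_segment {v : Fin 2 → ℤ} (hv : IsCoprime (v 0) (v 1)) :
    HasAffineGrowth (segment ℝ 0 (latticeEmb v)) := by
  refine ⟨fun X => (((fun c : ℤ => (c : ℝ)) ⁻¹' (levelForm v '' X)).ncard : ℝ), 1,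
    fun X hX => ?_, fun X Y hX hY => ?_⟩
  · rw [latticeCount_add_segment hv hX, Nat.cast_add]
  · have h := ncard_levels_add hX hY v
    dsimp only
    rw [eq_sub_iff_add_eq]
    exact_mod_cast h

theorem segment_zero (v : Fin 2 → ℤ) : HasAffineGrowth (segment ℝ 0 (latticeEmb v)) := by
  by_cases hv : v = 0
  · subst hv
    simpa using singleton 0
  have hgcd : 0 < Int.gcd (v 0) (v 1) := by
    refine Nat.pos_of_ne_zero fun h => hv ?_
    obtain ⟨h0, h1⟩ := Int.gcd_eq_zero_iff.1 h
    ext i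
    fin_cases i <;> assumption
  obtain ⟨a, b, hab, h0, h1⟩ := Int.exists_gcd_one hgcd
  have hprim := primitive_segment (v := ![a, b]) (Int.isCoprime_iff_gcd_eq_one.2 hab)
  have hmul (n : ℕ) : HasAffineGrowth (segment ℝ 0 (latticeEmb (n • ![a, b]))) := by
    induction n with
    | zero => simpa using singleton 0
    | succ n ih =>
      have hseg := IsLatticePolygon.segment 0 (n • ![a, b])
      rw [map_zero] at hseg
      convert ih.add hprim hseg using 1
      have hsmul (c : ℝ) : segment ℝ 0 (c • latticeEmb ![a, b]) =
          c • segment ℝ 0 (latticeEmb ![a, b]) := by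
        rw [← convexHull_pair, ← convexHull_pair, ← convexHull_smul, ← Set.image_smul,
          Set.image_pair, smul_zero]
      simp only [map_nsmul, ← Nat.cast_smul_eq_nsmul ℝ]
      rw [hsmul, hsmul, Nat.cast_succ,
        (convex_segment _ _).add_smul (by positivity) zero_le_one, one_smul]
  convert hmul (Int.gcd (v 0) (v 1))
  ext i
  fin_cases i
  · simpa [mul_comm] using h0
  · simpa [mul_comm] using h1

theorem segment (p q : Fin 2 → ℤ) :
    HasAffineGrowth (segment ℝ (latticeEmb p) (latticeEmb q)) := by
  convert (singleton p).add (segment_zero (q - p)) (.singleton p) using 1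
  rw [Set.singleton_add, segment_translate_image]
  simp

theorem parallelogram (p u v : Fin 2 → ℤ) :
    HasAffineGrowth ({latticeEmb p} +
      (_root_.segment ℝ 0 (latticeEmb u) + _root_.segment ℝ 0 (latticeEmb v))) := by
  refine (singleton p).add ((segment_zero u).add (segment_zero v) ?_) (.singleton p)
  simpa using IsLatticePolygon.segment 0 u

end HasAffineGrowth

/-- The third difference at `{0}` of the lattice point count. -/
noncomputable def thirdDifference (A B C : Set (Fin 2 → ℝ)) : ℝ :=
  latticeCount (A + B + C) - latticeCount (A + B) - latticeCount (A + C) - latticeCount (B + C)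
    + latticeCount A + latticeCount B + latticeCount C - 1

section thirdDifference

variable {A B C P Q : Set (Fin 2 → ℝ)}

theorem thirdDifference_swap_right (A B C : Set (Fin 2 → ℝ)) :
    thirdDifference A B C = thirdDifference A C B := by
  simp only [thirdDifference, add_right_comm A B C, add_comm B C]
  ring

theorem thirdDifference_rotate (A B C : Set (Fin 2 → ℝ)) :
    thirdDifference A B C = thirdDifference B C A := by
  simp only [thirdDifference, add_comm A, add_right_comm B A C]
  ring

theorem thirdDifference_neg (A B C : Set (Fin 2 → ℝ)) :
    thirdDifference (-A) (-B) (-C) = thirdDifference A B C := by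
  simp only [thirdDifference, ← neg_add, latticeCount_neg]

theorem thirdDifference_add_singleton (A B C : Set (Fin 2 → ℝ)) (p : Fin 2 → ℤ) :
    thirdDifference A B (C + {latticeEmb p}) = thirdDifference A B C := by
  simp only [thirdDifference, ← add_assoc, latticeCount_add_singleton]

theorem HasAffineGrowth.thirdDifference_eq_zero (hC : HasAffineGrowth C)
    (hA : IsLatticePolygon A) (hB : IsLatticePolygon B) : thirdDifference A B C = 0 := by
  obtain ⟨w, k, hw, hw'⟩ := hC
  have h0 : IsLatticePolygon {0} := by simpa using IsLatticePolygon.singleton 0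
  have hk := hw' {0} {0} h0 h0
  have hC := hw {0} h0
  rw [Set.singleton_zero, zero_add] at hk hC
  rw [← Set.singleton_zero, latticeCount_zero, Set.singleton_zero] at hC
  rw [thirdDifference, hw _ (hA.add hB), hw A hA, hw B hB, hC, hw' A B hA hB]
  push_cast
  linarith

theorem latticeCount_add_valuation (hP : IsLatticePolygon P) (hQ : IsLatticePolygon Q)
    (hPQ : Convex ℝ (P ∪ Q)) (hC : IsLatticePolygon C) :
    (latticeCount (C + (P ∪ Q)) : ℝ) + latticeCount (C + P ∩ Q) =
      latticeCount (C + P) + latticeCount (C + Q) := by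
  simp only [add_comm C]
  rw [Set.union_add, inter_add_of_convex_union hP.isCompact.isClosed hQ.isCompact.isClosed hPQ
    hC.convex]
  exact_mod_cast latticeCount_union_add_inter (hP.add hC) (hQ.add hC)

theorem thirdDifference_valuation (hA : IsLatticePolygon A) (hB : IsLatticePolygon B)
    (hP : IsLatticePolygon P) (hQ : IsLatticePolygon Q) (hPQ : Convex ℝ (P ∪ Q)) :
    thirdDifference A B (P ∪ Q) + thirdDifference A B (P ∩ Q) =
      thirdDifference A B P + thirdDifference A B Q := by
  have h1 := latticeCount_add_valuation hP hQ hPQ (hA.add hB)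
  have h2 := latticeCount_add_valuation hP hQ hPQ hA
  have h3 := latticeCount_add_valuation hP hQ hPQ hB
  have h4 : (latticeCount (P ∪ Q) : ℝ) + latticeCount (P ∩ Q) = latticeCount P + latticeCount Q :=
    mod_cast latticeCount_union_add_inter hP hQ
  simp only [thirdDifference]
  linear_combination h1 - h2 - h3 + h4

end thirdDifference

theorem mem_convexHull_triple {E : Type*} [AddCommGroup E] [Module ℝ E] {p q r x : E} :
    x ∈ convexHull ℝ {p, q, r} ↔
      ∃ s t : ℝ, 0 ≤ s ∧ 0 ≤ t ∧ s + t ≤ 1 ∧ x = p + s • (q - p) + t • (r - p) := by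
  constructor
  · intro hx
    rw [convexHull_insert (by simp), convexHull_pair, mem_convexJoin] at hx
    obtain ⟨_, rfl, y, ⟨c, d, hc, hd, hcd, rfl⟩, ⟨a, b, ha, hb, hab, rfl⟩⟩ := hx
    refine ⟨b * c, b * d, by positivity, by positivity, ?_, ?_⟩
    · rw [← mul_add, hcd]
      linarith
    · obtain rfl : a = 1 - b := by linarith
      obtain rfl : c = 1 - d := by linarith
      module
  · rintro ⟨s, t, hs, ht, hst, rfl⟩
    have hp : p ∈ convexHull ℝ {p, q, r} := subset_convexHull ℝ _ (by simp)
    have hq : q ∈ convexHull ℝ {p, q, r} := subset_convexHull ℝ _ (by simp)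
    have hr : r ∈ convexHull ℝ {p, q, r} := subset_convexHull ℝ _ (by simp)
    have h := (convex_convexHull ℝ {p, q, r}).sum_mem (t := Finset.univ)
      (w := ![1 - s - t, s, t]) (z := ![p, q, r])
      (by
        intro i _
        fin_cases i <;> simp <;> linarith)
      (by
        rw [Fin.sum_univ_three]
        change 1 - s - t + s + t = 1
        ring)
      (by
        intro i _
        fin_cases i <;> simpa)
    convert h using 1
    rw [Fin.sum_univ_three]
    change _ = (1 - s - t) • p + s • q + t • r
    module

theorem convexHull_triple_union_reflection {E : Type*} [AddCommGroup E] [Module ℝ E] (p q r : E) :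
    convexHull ℝ {p, q, r} ∪ (-convexHull ℝ {p, q, r} + {q + r}) =
      {p} + (segment ℝ 0 (q - p) + segment ℝ 0 (r - p)) := by
  have mem_seg {u x : E} : x ∈ segment ℝ 0 u ↔ ∃ s ∈ Set.Icc (0 : ℝ) 1, s • u = x := by
    simp [segment_eq_image]
  ext x
  simp only [Set.mem_union, mem_convexHull_triple, Set.add_singleton, Set.image_add_right,
    Set.mem_preimage, Set.mem_neg, Set.singleton_add, Set.image_add_left]
  constructor
  · rintro (⟨s, t, hs, ht, hst, rfl⟩ | ⟨s, t, hs, ht, hst, h⟩)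
    · refine ⟨_, mem_seg.2 ⟨s, ⟨hs, by linarith⟩, rfl⟩, _, mem_seg.2 ⟨t, ⟨ht, by linarith⟩, rfl⟩, ?_⟩
      dsimp only
      module
    · refine ⟨_, mem_seg.2 ⟨1 - s, ⟨by linarith, by linarith⟩, rfl⟩,
        _, mem_seg.2 ⟨1 - t, ⟨by linarith, by linarith⟩, rfl⟩, ?_⟩
      obtain rfl : x = q + r - (p + s • (q - p) + t • (r - p)) := by
        rw [← h]
        abel
      dsimp only
      module
  · rintro ⟨_, h1, _, h2, h⟩
    obtain ⟨s, ⟨hs, hs'⟩, rfl⟩ := mem_seg.1 h1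
    obtain ⟨t, ⟨ht, ht'⟩, rfl⟩ := mem_seg.1 h2
    obtain rfl : x = p + (s • (q - p) + t • (r - p)) := by
      dsimp only at h
      rw [h]
      abel
    rcases le_total (s + t) 1 with hst | hst
    · exact Or.inl ⟨s, t, hs, ht, hst, by module⟩
    · exact Or.inr ⟨1 - s, 1 - t, by linarith, by linarith, by linarith, by module⟩

theorem convexHull_triple_inter_reflection {E : Type*} [AddCommGroup E] [Module ℝ E] (p q r : E) :
    convexHull ℝ {p, q, r} ∩ (-convexHull ℝ {p, q, r} + {q + r}) = segment ℝ q r := by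
  ext x
  simp only [Set.mem_inter_iff, mem_convexHull_triple, Set.add_singleton, Set.image_add_right,
    Set.mem_preimage, Set.mem_neg]
  constructor
  · rintro ⟨⟨s, t, hs, ht, hst, h⟩, s', t', hs', ht', hst', h'⟩
    have h'' : x = q + r - (p + s' • (q - p) + t' • (r - p)) := by
      rw [← h']
      abel
    -- interpolate between the two parameters of `x` so that they sum to one
    obtain ⟨c, hc0, hc1, hc⟩ : ∃ c : ℝ, 0 ≤ c ∧ c ≤ 1 ∧
        (1 - c) * (s + t) + c * ((1 - s') + (1 - t')) = 1 := by
      by_cases h0 : s + t = 1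
      · exact ⟨0, le_rfl, zero_le_one, by linarith⟩
      · have hpos : 0 < 2 - s' - t' - s - t := by
          have := lt_of_le_of_ne hst h0
          linarith
        refine ⟨(1 - s - t) / (2 - s' - t' - s - t), div_nonneg (by linarith) hpos.le,
          (div_le_one hpos).2 (by linarith), ?_⟩
        field_simp
        ring
    have hs1 : 0 ≤ 1 - s' := by linarith
    have ht1 : 0 ≤ 1 - t' := by linarith
    have hc' : 0 ≤ 1 - c := by linarith
    refine ⟨(1 - c) * s + c * (1 - s'), (1 - c) * t + c * (1 - t'), by positivity, by positivity,
      by linarith, ?_⟩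
    have hx : x = (1 - c) • x + c • x := by module
    rw [hx]
    nth_rw 1 [h]
    rw [h'']
    have hq : (1 - c) * s + c * (1 - s') = 1 - ((1 - c) * t + c * (1 - t')) := by linarith
    have hp : p = ((1 - c) * (s + t) + c * ((1 - s') + (1 - t'))) • p := by rw [hc, one_smul]
    have : ((1 - c) * s + c * (1 - s')) • q + ((1 - c) * t + c * (1 - t')) • r =
        p + ((1 - c) * s + c * (1 - s')) • q + ((1 - c) * t + c * (1 - t')) • r
          - ((1 - c) * (s + t) + c * ((1 - s') + (1 - t'))) • p := by
      rw [← hp]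
      abel
    rw [this]
    module
  · rintro ⟨a, b, ha, hb, hab, rfl⟩
    obtain rfl : a = 1 - b := by linarith
    exact ⟨⟨1 - b, b, ha, hb, by linarith, by module⟩, b, 1 - b, hb, ha, by linarith, by module⟩

/-- The third difference is odd on triangles. -/
theorem thirdDifference_convexHull_triple {A B : Set (Fin 2 → ℝ)} (hA : IsLatticePolygon A)
    (hB : IsLatticePolygon B) (p q r : Fin 2 → ℤ) :
    thirdDifference A B (convexHull ℝ {latticeEmb p, latticeEmb q, latticeEmb r}) +
      thirdDifference A B (-convexHull ℝ {latticeEmb p, latticeEmb q, latticeEmb r}) = 0 := by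
  classical
  set T := convexHull ℝ {latticeEmb p, latticeEmb q, latticeEmb r} with hT
  have hTpoly : IsLatticePolygon T :=
    ⟨{p, q, r}, by simp, by simp [hT, Set.image_insert_eq]⟩
  have hT' : IsLatticePolygon (-T + {latticeEmb (q + r)}) := hTpoly.neg.add (.singleton _)
  have hunion := convexHull_triple_union_reflection (latticeEmb p) (latticeEmb q) (latticeEmb r)
  have hinter := convexHull_triple_inter_reflection (latticeEmb p) (latticeEmb q) (latticeEmb r)
  rw [← map_add, ← hT] at hunion hinter
  rw [← map_sub, ← map_sub] at hunion
  have hconv : Convex ℝ (T ∪ (-T + {latticeEmb (q + r)})) := by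
    rw [hunion]
    exact (convex_singleton _).add ((convex_segment _ _).add (convex_segment _ _))
  have h := thirdDifference_valuation hA hB hTpoly hT' hconv
  rw [hunion, hinter, thirdDifference_add_singleton,
    (HasAffineGrowth.parallelogram _ _ _).thirdDifference_eq_zero hA hB,
    (HasAffineGrowth.segment _ _).thirdDifference_eq_zero hA hB] at h
  linarith

/-- The affine form `x ↦ det (b - a, x - a)` on `ℝ²`, which vanishes on the line through
`a` and `b`. -/
def orientation (a b : Fin 2 → ℝ) : (Fin 2 → ℝ) →ᵃ[ℝ] ℝ :=
  let f : (Fin 2 → ℝ) →ₗ[ℝ] ℝ :=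
    (b 0 - a 0) • LinearMap.proj 1 - (b 1 - a 1) • LinearMap.proj 0
  f.toAffineMap - AffineMap.const ℝ _ (f a)

theorem orientation_apply (a b x : Fin 2 → ℝ) :
    orientation a b x = (b 0 - a 0) * (x 1 - a 1) - (b 1 - a 1) * (x 0 - a 0) := by
  simp [orientation]
  ring

/-- The line through two extreme points meets a set only in the segment between them. -/
theorem mem_segment_of_orientation_eq_zero {P : Set (Fin 2 → ℝ)} {a b z : Fin 2 → ℝ}
    (ha : a ∈ P.extremePoints ℝ) (hb : b ∈ P.extremePoints ℝ) (hab : a ≠ b) (hz : z ∈ P)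
    (h : orientation a b z = 0) : z ∈ segment ℝ a b := by
  rw [mem_extremePoints] at ha hb
  rw [orientation_apply] at h
  have hN : 0 < (b 0 - a 0) ^ 2 + (b 1 - a 1) ^ 2 := by
    by_contra! hle
    have h0 : b 0 - a 0 = 0 := by nlinarith [sq_nonneg (b 0 - a 0), sq_nonneg (b 1 - a 1)]
    have h1 : b 1 - a 1 = 0 := by nlinarith [sq_nonneg (b 0 - a 0), sq_nonneg (b 1 - a 1)]
    refine hab ?_
    ext i
    fin_cases i
    · exact (sub_eq_zero.1 h0).symm
    · exact (sub_eq_zero.1 h1).symm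
  obtain ⟨t, ht⟩ : ∃ t : ℝ, z = a + t • (b - a) := by
    refine ⟨((b 0 - a 0) * (z 0 - a 0) + (b 1 - a 1) * (z 1 - a 1)) /
      ((b 0 - a 0) ^ 2 + (b 1 - a 1) ^ 2), ?_⟩
    ext i
    fin_cases i
    · simp
      field_simp
      linear_combination -(b 1 - a 1) * h
    · simp
      field_simp
      linear_combination (b 0 - a 0) * h
  rcases lt_or_ge t 0 with h0 | h0
  · refine (hab (ha.2 z hz b hb.1 ⟨1 / (1 - t), -t / (1 - t), ?_, ?_, ?_, ?_⟩).2.symm).elim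
    · exact div_pos one_pos (by linarith)
    · exact div_pos (by linarith) (by linarith)
    · have : 1 - t ≠ 0 := by linarith
      field_simp
      ring
    · have : 1 - t ≠ 0 := by linarith
      rw [ht]
      ext i
      simp
      field_simp
      ring
  rcases lt_or_ge 1 t with h1 | h1
  · refine (hab (hb.2 a ha.1 z hz ⟨1 - 1 / t, 1 / t, ?_, ?_, ?_, ?_⟩).1).elim
    · exact sub_pos.2 ((div_lt_one (by linarith)).2 h1)
    · exact div_pos one_pos (by linarith)
    · ring
    · have : t ≠ 0 := by linarith
      rw [ht]
      ext i
      simp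
      field_simp
      ring
  · exact ⟨1 - t, t, by linarith, h0, by ring, by rw [ht]; module⟩

/-- Cutting the convex hull of a finite set along the line through two extreme points. -/
theorem convexHull_cut {S : Set (Fin 2 → ℝ)} {a b : Fin 2 → ℝ} (haS : a ∈ S) (hbS : b ∈ S)
    (ha : a ∈ (convexHull ℝ S).extremePoints ℝ) (hb : b ∈ (convexHull ℝ S).extremePoints ℝ)
    (hab : a ≠ b) :
    convexHull ℝ {x ∈ S | 0 ≤ orientation a b x} ∪ convexHull ℝ {x ∈ S | orientation a b x ≤ 0} =
        convexHull ℝ S ∧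
      convexHull ℝ {x ∈ S | 0 ≤ orientation a b x} ∩ convexHull ℝ {x ∈ S | orientation a b x ≤ 0} =
        segment ℝ a b := by
  set f := orientation a b with hf
  have hfa : f a = 0 := by simp [hf, orientation_apply]
  have hfb : f b = 0 := by
    rw [hf, orientation_apply]
    ring
  set Sp := {x ∈ S | 0 ≤ f x}
  set Sm := {x ∈ S | f x ≤ 0}
  have hap : a ∈ Sp := ⟨haS, hfa.ge⟩
  have hbp : b ∈ Sp := ⟨hbS, hfb.ge⟩
  have ham : a ∈ Sm := ⟨haS, hfa.le⟩
  have hbm : b ∈ Sm := ⟨hbS, hfb.le⟩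
  have hsegp : segment ℝ a b ⊆ convexHull ℝ Sp := (convex_convexHull ℝ _).segment_subset
    (subset_convexHull ℝ _ hap) (subset_convexHull ℝ _ hbp)
  have hsegm : segment ℝ a b ⊆ convexHull ℝ Sm := (convex_convexHull ℝ _).segment_subset
    (subset_convexHull ℝ _ ham) (subset_convexHull ℝ _ hbm)
  have hsubp : convexHull ℝ Sp ⊆ convexHull ℝ S := convexHull_mono (Set.sep_subset _ _)
  have hsubm : convexHull ℝ Sm ⊆ convexHull ℝ S := convexHull_mono (Set.sep_subset _ _)
  have hfp : ∀ x ∈ convexHull ℝ Sp, 0 ≤ f x :=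
    convexHull_min (fun x hx => hx.2) ((convex_Ici 0).affine_preimage f)
  have hfm : ∀ x ∈ convexHull ℝ Sm, f x ≤ 0 :=
    convexHull_min (fun x hx => hx.2) ((convex_Iic 0).affine_preimage f)
  have hline {z : Fin 2 → ℝ} (hz : z ∈ convexHull ℝ S) (h : f z = 0) : z ∈ segment ℝ a b :=
    mem_segment_of_orientation_eq_zero ha hb hab hz h
  constructor
  · refine (Set.union_subset hsubp hsubm).antisymm fun x hx => ?_
    have hS : Sp ∪ Sm = S := by
      ext y
      simp only [Sp, Sm, Set.mem_union, Set.mem_sep_iff]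
      have := le_total 0 (f y)
      tauto
    have hx' := hx
    rw [← hS, convexHull_union ⟨a, hap⟩ ⟨a, ham⟩, mem_convexJoin] at hx'
    obtain ⟨p, hp, q, hq, hxpq⟩ := hx'
    have hp' := hfp p hp
    have hq' := hfm q hq
    -- the segment from `p` to `q` crosses the line at some point `z`
    obtain ⟨z, hz, hfz⟩ : ∃ z ∈ segment ℝ p q, f z = 0 := by
      have himage : f '' segment ℝ p q = segment ℝ (f p) (f q) := image_segment ℝ f p q
      have h0 : (0 : ℝ) ∈ f '' segment ℝ p q := by
        rw [himage, segment_symm, segment_eq_Icc (hq'.trans hp')]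
        exact ⟨hq', hp'⟩
      exact h0
    have hzab := hline ((convex_convexHull ℝ S).segment_subset (hsubp hp) (hsubm hq) hz) hfz
    have hsplit : x ∈ segment ℝ p z ∨ x ∈ segment ℝ z q := by
      rw [segment_eq_image_lineMap] at hxpq hz
      obtain ⟨s, hs, rfl⟩ := hxpq
      obtain ⟨τ, hτ, rfl⟩ := hz
      rcases le_total s τ with h | h
      · left
        have := image_segment ℝ (AffineMap.lineMap p q : ℝ →ᵃ[ℝ] Fin 2 → ℝ) 0 τ
        rw [AffineMap.lineMap_apply_zero, segment_eq_Icc hτ.1] at this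
        exact this ▸ Set.mem_image_of_mem _ ⟨hs.1, h⟩
      · right
        have := image_segment ℝ (AffineMap.lineMap p q : ℝ →ᵃ[ℝ] Fin 2 → ℝ) τ 1
        rw [AffineMap.lineMap_apply_one, segment_eq_Icc hτ.2] at this
        exact this ▸ Set.mem_image_of_mem _ ⟨h, hs.2⟩
    rcases hsplit with h | h
    · exact Or.inl ((convex_convexHull ℝ _).segment_subset hp (hsegp hzab) h)
    · exact Or.inr ((convex_convexHull ℝ _).segment_subset (hsegm hzab) hq h)
  · refine Set.Subset.antisymm (fun x hx => hline (hsubp hx.1) ?_) (Set.subset_inter hsegp hsegm)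
    exact (hfm x hx.2).antisymm (hfp x hx.1)

/-- Among four extreme points, some two are strictly separated by the line through the
other two. -/
theorem exists_orientation_neg_pos {P : Set (Fin 2 → ℝ)} (hP : Convex ℝ P) {a b c d : Fin 2 → ℝ}
    (ha : a ∈ P.extremePoints ℝ) (hb : b ∈ P.extremePoints ℝ) (hc : c ∈ P.extremePoints ℝ)
    (hd : d ∈ P.extremePoints ℝ) (hab : a ≠ b) (hac : a ≠ c) (hbc : b ≠ c)
    (hda : d ≠ a) (hdb : d ≠ b) (hdc : d ≠ c) :
    orientation a b c * orientation a b d < 0 ∨ orientation b c a * orientation b c d < 0 ∨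
      orientation c a b * orientation c a d < 0 := by
  by_contra! h
  obtain ⟨h1, h2, h3⟩ := h
  have hbca : orientation b c a = orientation a b c := by
    simp only [orientation_apply]
    ring
  have hcab : orientation c a b = orientation a b c := by
    simp only [orientation_apply]
    ring
  rw [hbca] at h2
  rw [hcab] at h3
  have hne : orientation a b c ≠ 0 := fun h => by
    have := mem_segment_of_orientation_eq_zero ha hb hab hc.1 h
    rcases (mem_extremePoints_iff_forall_segment.1 hc).2 a ha.1 b hb.1 this with h | h
    · exact hac h
    · exact hbc h
  have hsum : orientation a b d + orientation b c d + orientation c a d = orientation a b c := by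
    simp only [orientation_apply]
    ring
  have hdiv {x : ℝ} (hx : 0 ≤ orientation a b c * x) : 0 ≤ x / orientation a b c := by
    have := div_nonneg hx (sq_nonneg (orientation a b c))
    rwa [sq, mul_div_mul_left _ _ hne] at this
  have hmem : d ∈ convexHull ℝ {a, b, c} := by
    refine mem_convexHull_triple.2 ⟨_, _, hdiv h3, hdiv h1, ?_, ?_⟩
    · have := hdiv h2
      have h4 : orientation c a d / orientation a b c + orientation a b d / orientation a b c +
          orientation b c d / orientation a b c = 1 := by
        rw [← add_div, ← add_div, div_eq_one_iff_eq hne]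
        linarith
      linarith
    · ext i
      simp
      field_simp
      simp only [orientation_apply]
      fin_cases i <;> simp <;> ring
  refine (hP.mem_extremePoints_iff_mem_sdiff_convexHull_sdiff.1 hd).2 (convexHull_mono ?_ hmem)
  rintro x (rfl | rfl | rfl)
  · exact ⟨ha.1, hda.symm⟩
  · exact ⟨hb.1, hdb.symm⟩
  · exact ⟨hc.1, hdc.symm⟩

/-- A valuation on lattice polygons is zero if it vanishes on all triangles, degenerate
ones included. -/
theorem IsLatticePolygon.valuation_eq_zero {φ : Set (Fin 2 → ℝ) → ℝ}
    (hφ : ∀ P Q, IsLatticePolygon P → IsLatticePolygon Q → Convex ℝ (P ∪ Q) →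
      φ (P ∪ Q) + φ (P ∩ Q) = φ P + φ Q)
    (htri : ∀ p q r, φ (convexHull ℝ {latticeEmb p, latticeEmb q, latticeEmb r}) = 0)
    {P : Set (Fin 2 → ℝ)} (hP : IsLatticePolygon P) : φ P = 0 := by
  classical
  obtain ⟨V, hV, rfl⟩ := hP
  induction hn : V.card using Nat.strong_induction_on generalizing V with
  | _ n ih =>
  obtain ⟨W, hWV, hWconv, hWext⟩ := IsLatticePolygon.exists_subset_extremePoints V
  have hWcard := Finset.card_le_card hWV
  rw [← hWconv] at hWext ⊢
  have hext {p : Fin 2 → ℤ} (hp : p ∈ W) :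
      latticeEmb p ∈ (convexHull ℝ (latticeEmb '' (W : Set (Fin 2 → ℤ)))).extremePoints ℝ :=
    hWext ⟨p, hp, rfl⟩
  have hWne : W.Nonempty := by
    have := (hV.to_set.image latticeEmb).convexHull (𝕜 := ℝ)
    rw [← hWconv, convexHull_nonempty_iff] at this
    simpa using this
  have cut {a b c d : Fin 2 → ℤ} (ha : a ∈ W) (hb : b ∈ W) (hc : c ∈ W) (hd : d ∈ W)
      (hab : a ≠ b) (hcd : orientation (latticeEmb a) (latticeEmb b) (latticeEmb c) *
        orientation (latticeEmb a) (latticeEmb b) (latticeEmb d) < 0) :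
      φ (convexHull ℝ (latticeEmb '' W)) = 0 := by
    set f := orientation (latticeEmb a) (latticeEmb b) with hf
    obtain ⟨hunion, hinter⟩ := convexHull_cut (Set.mem_image_of_mem _ ha)
      (Set.mem_image_of_mem _ hb) (hext ha) (hext hb) (latticeEmb_injective.ne hab)
    have hsep (p : (Fin 2 → ℝ) → Prop) : {x ∈ latticeEmb '' (W : Set (Fin 2 → ℤ)) | p x} =
        latticeEmb '' ({x ∈ W | p (latticeEmb x)} : Finset (Fin 2 → ℤ)) := by
      ext x
      constructor
      · rintro ⟨⟨y, hy, rfl⟩, h⟩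
        exact ⟨y, by simpa using ⟨hy, h⟩, rfl⟩
      · rintro ⟨y, hy, rfl⟩
        rw [Finset.mem_coe, Finset.mem_filter] at hy
        exact ⟨⟨y, hy.1, rfl⟩, hy.2⟩
    rw [hsep, hsep] at hunion hinter
    have hfa : f (latticeEmb a) = 0 := by
      rw [hf, orientation_apply]
      ring
    have hpne : ({x ∈ W | 0 ≤ f (latticeEmb x)}).Nonempty :=
      ⟨a, Finset.mem_filter.2 ⟨ha, hfa.ge⟩⟩
    have hmne : ({x ∈ W | f (latticeEmb x) ≤ 0}).Nonempty :=
      ⟨a, Finset.mem_filter.2 ⟨ha, hfa.le⟩⟩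
    have hpcard : ({x ∈ W | 0 ≤ f (latticeEmb x)}).card < n := by
      refine (Finset.card_lt_card (Finset.filter_ssubset.2 ?_)).trans_le (hn ▸ hWcard)
      rcases mul_neg_iff.1 hcd with h | h
      · exact ⟨d, hd, not_le.2 h.2⟩
      · exact ⟨c, hc, not_le.2 h.1⟩
    have hmcard : ({x ∈ W | f (latticeEmb x) ≤ 0}).card < n := by
      refine (Finset.card_lt_card (Finset.filter_ssubset.2 ?_)).trans_le (hn ▸ hWcard)
      rcases mul_neg_iff.1 hcd with h | h
      · exact ⟨c, hc, not_le.2 h.1⟩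
      · exact ⟨d, hd, not_le.2 h.2⟩
    have hval := hφ _ _ ⟨_, hpne, rfl⟩ ⟨_, hmne, rfl⟩
      (by
        rw [hunion]
        exact convex_convexHull ℝ _)
    have hseg : φ (_root_.segment ℝ (latticeEmb a) (latticeEmb b)) = 0 := by
      simpa [convexHull_pair] using htri a b b
    rw [hunion, hinter, ih _ hpcard _ hpne rfl, ih _ hmcard _ hmne rfl, hseg] at hval
    simpa using hval
  rcases lt_or_ge 3 W.card with h3 | h3
  · obtain ⟨a, ha, b, hb, c, hc, hab, hac, hbc⟩ := Finset.two_lt_card.1 (by lia : 2 < W.card)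
    obtain ⟨d, hd, hdabc⟩ := Finset.exists_mem_notMem_of_card_lt_card
      ((Finset.card_le_three (a := a) (b := b) (c := c)).trans_lt h3)
    simp only [Finset.mem_insert, Finset.mem_singleton, not_or] at hdabc
    obtain ⟨hda, hdb, hdc⟩ := hdabc
    have hne {x y : Fin 2 → ℤ} (h : x ≠ y) := latticeEmb_injective.ne h
    rcases exists_orientation_neg_pos (convex_convexHull ℝ _) (hext ha) (hext hb) (hext hc)
      (hext hd) (hne hab) (hne hac) (hne hbc) (hne hda) (hne hdb) (hne hdc) with h | h | h
    · exact cut ha hb hc hd hab h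
    · exact cut hb hc ha hd hbc h
    · exact cut hc ha hb hd hac.symm h
  · obtain h | h | h : W.card = 1 ∨ W.card = 2 ∨ W.card = 3 := by
      have := hWne.card_pos
      lia
    · obtain ⟨a, rfl⟩ := Finset.card_eq_one.1 h
      simpa using htri a a a
    · obtain ⟨a, b, -, rfl⟩ := Finset.card_eq_two.1 h
      simpa [Set.image_insert_eq] using htri a b b
    · obtain ⟨a, b, c, -, -, -, rfl⟩ := Finset.card_eq_three.1 h
      simpa [Set.image_insert_eq] using htri a b c

/-- The third difference of the lattice point count vanishes on lattice polygons. -/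
theorem thirdDifference_eq_zero {A B C : Set (Fin 2 → ℝ)} (hA : IsLatticePolygon A)
    (hB : IsLatticePolygon B) (hC : IsLatticePolygon C) : thirdDifference A B C = 0 := by
  have odd {A B C : Set (Fin 2 → ℝ)} (hA : IsLatticePolygon A) (hB : IsLatticePolygon B)
      (hC : IsLatticePolygon C) : thirdDifference A B C + thirdDifference A B (-C) = 0 := by
    refine IsLatticePolygon.valuation_eq_zero
      (φ := fun C => thirdDifference A B C + thirdDifference A B (-C)) (fun P Q hP hQ hPQ => ?_)
      (thirdDifference_convexHull_triple hA hB) hC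
    have h1 := thirdDifference_valuation hA hB hP hQ hPQ
    have h2 := thirdDifference_valuation hA hB hP.neg hQ.neg (by
      rw [← Set.union_neg]
      exact hPQ.neg)
    rw [← Set.union_neg, ← Set.inter_neg] at h2
    linarith
  have h1 := odd hA hB hC
  have h2 := odd hA hC.neg hB
  have h3 := odd hB.neg hC.neg hA
  rw [thirdDifference_swap_right, thirdDifference_swap_right A (-C) (-B)] at h2
  rw [← thirdDifference_rotate A, ← thirdDifference_rotate (-A), thirdDifference_neg] at h3
  linarith

/-- Points of `P` in the refined lattice `n⁻¹ ℤ²` correspond to lattice points of `n • P`. -/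
theorem card_inter_inv_smul_span (P : Set (Fin 2 → ℝ)) {n : ℕ} (hn : n ≠ 0) :
    Nat.card ↑(P ∩ (n : ℝ)⁻¹ •
      (Submodule.span ℤ (Set.range (Pi.basisFun ℝ (Fin 2))) : Set (Fin 2 → ℝ))) =
      latticeCount ((n : ℝ) • P) := by
  have hn' : (n : ℝ) ≠ 0 := Nat.cast_ne_zero.2 hn
  rw [Nat.card_coe_set_eq, latticeCount_eq_ncard_preimage,
    ← Set.ncard_image_of_injective (latticeEmb ⁻¹' _) latticeEmb_injective,
    ← Set.ncard_image_of_injective _ (smul_right_injective _ hn')]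
  congr 1
  have himage : (fun x : Fin 2 → ℝ => (n : ℝ) • x) '' (P ∩ (n : ℝ)⁻¹ •
      (Submodule.span ℤ (Set.range (Pi.basisFun ℝ (Fin 2))) : Set (Fin 2 → ℝ))) =
      (n : ℝ) • P ∩ (Submodule.span ℤ (Set.range (Pi.basisFun ℝ (Fin 2))) : Set (Fin 2 → ℝ)) := by
    rw [Set.image_smul, Set.smul_set_inter₀ hn', smul_inv_smul₀ hn']
  rw [himage, Set.image_preimage_eq_inter_range]
  congr 1
  ext x
  rw [SetLike.mem_coe, Module.Basis.mem_span_iff_repr_mem]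
  simp only [Set.mem_range, Pi.basisFun_repr, algebraMap_int_eq, eq_intCast]
  constructor
  · intro h
    choose a ha using h
    exact ⟨a, funext ha⟩
  · rintro ⟨a, rfl⟩ i
    exact ⟨a i, rfl⟩

theorem IsLatticePolygon.nat_smul {P : Set (Fin 2 → ℝ)} (hP : IsLatticePolygon P) (n : ℕ) :
    IsLatticePolygon ((n : ℝ) • P) := by
  induction n with
  | zero =>
    rw [Nat.cast_zero, Set.zero_smul_set hP.nonempty, ← Set.singleton_zero]
    simpa using IsLatticePolygon.singleton 0
  | succ n ih =>
    rw [Nat.cast_succ, hP.convex.add_smul (by positivity) zero_le_one, one_smul]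
    exact ih.add hP

/-- The lattice point count of the dilates of a lattice polygon is a quadratic polynomial. -/
theorem IsLatticePolygon.latticeCount_nat_smul {P : Set (Fin 2 → ℝ)} (hP : IsLatticePolygon P)
    (n : ℕ) : (latticeCount ((n : ℝ) • P) : ℝ) =
      1 + n * (latticeCount P - 1) +
        n * (n - 1) / 2 * (latticeCount (P + P) - 2 * latticeCount P + 1) := by
  have hsucc (n : ℕ) : ((n + 1 : ℕ) : ℝ) • P = (n : ℝ) • P + P := by
    rw [Nat.cast_succ, hP.convex.add_smul (by positivity) zero_le_one, one_smul]
  have h0 : ((0 : ℕ) : ℝ) • P = {0} := by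
    rw [Nat.cast_zero, Set.zero_smul_set hP.nonempty, Set.singleton_zero]
  induction n using Nat.twoStepInduction with
  | zero =>
    rw [h0, latticeCount_zero]
    simp
  | one => simp
  | more n ih1 ih2 =>
    have h := thirdDifference_eq_zero (hP.nat_smul n) hP hP
    rw [thirdDifference, ← hsucc, ← hsucc] at h
    rw [show n + 2 = n + 1 + 1 from rfl]
    rw [ih1, ih2] at h
    push_cast at h ⊢
    linarith

/-- The volume of a lattice polygon `P` in terms of the number of lattice points of
`P` and `2P`. -/
theorem IsLatticePolygon.volume_eq {P : Set (Fin 2 → ℝ)} (hP : IsLatticePolygon P) :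
    (volume P).toReal = ((latticeCount (P + P) : ℝ) - 2 * latticeCount P + 1) / 2 := by
  set q : ℝ := (latticeCount (P + P) : ℝ) - 2 * latticeCount P + 1
  have hlim := tendsto_card_div_pow_atTop_volume P hP.isCompact.isBounded
    hP.isCompact.isClosed.measurableSet (hP.convex.addHaar_frontier volume)
  refine tendsto_nhds_unique hlim ?_
  have hinv : Filter.Tendsto (fun n : ℕ => (n : ℝ)⁻¹) Filter.atTop (nhds 0) :=
    tendsto_inv_atTop_nhds_zero_nat
  have hpoly : Filter.Tendsto (fun n : ℕ => (n : ℝ)⁻¹ ^ 2 +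
      (n : ℝ)⁻¹ * (latticeCount P - 1) + (1 - (n : ℝ)⁻¹) / 2 * q) Filter.atTop
      (nhds (0 ^ 2 + 0 * (latticeCount P - 1) + (1 - 0) / 2 * q)) :=
    ((hinv.pow 2).add (hinv.mul_const _)).add (((hinv.const_sub 1).div_const 2).mul_const q)
  have hval : (0 : ℝ) ^ 2 + 0 * (latticeCount P - 1) + (1 - 0) / 2 * q = q / 2 := by ring
  rw [hval] at hpoly
  refine hpoly.congr' ?_
  filter_upwards [Filter.eventually_ne_atTop 0] with n hn
  have hn' : (n : ℝ) ≠ 0 := Nat.cast_ne_zero.2 hn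
  rw [card_inter_inv_smul_span P hn, hP.latticeCount_nat_smul n, Fintype.card_fin]
  field_simp
  ring

/-- For compact convex lattice polygons `P₁, P₂, U ⊆ ℝ²`,
`|(U+P₁+P₂) ∩ ℤ²| − |(U+P₁) ∩ ℤ²| − |(U+P₂) ∩ ℤ²| + |U ∩ ℤ²|
  = vol(P₁+P₂) − vol(P₁) − vol(P₂)`. -/
theorem latticeCount_parallelogram_law
    (P₁ P₂ U : Set (Fin 2 → ℝ)) (V₁ V₂ W : Finset (Fin 2 → ℤ))
    (hV₁ : V₁.Nonempty) (hV₂ : V₂.Nonempty) (hW : W.Nonempty)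
    (hP₁ : P₁ = convexHull ℝ ((fun (a : Fin 2 → ℤ) (i : Fin 2) => (a i : ℝ)) '' ↑V₁))
    (hP₂ : P₂ = convexHull ℝ ((fun (a : Fin 2 → ℤ) (i : Fin 2) => (a i : ℝ)) '' ↑V₂))
    (hU : U = convexHull ℝ ((fun (a : Fin 2 → ℤ) (i : Fin 2) => (a i : ℝ)) '' ↑W)) :
    (latticeCount (U + P₁ + P₂) : ℝ) - (latticeCount (U + P₁) : ℝ)
        - (latticeCount (U + P₂) : ℝ) + (latticeCount U : ℝ) =
      (volume (P₁ + P₂)).toReal - (volume P₁).toReal - (volume P₂).toReal := by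
  have h₁ : IsLatticePolygon P₁ := ⟨V₁, hV₁, hP₁⟩
  have h₂ : IsLatticePolygon P₂ := ⟨V₂, hV₂, hP₂⟩
  have h : IsLatticePolygon U := ⟨W, hW, hU⟩
  have hU₁₂ := thirdDifference_eq_zero h h₁ h₂
  have hsum₁₂ := thirdDifference_eq_zero (h₁.add h₂) h₁ h₂
  have h₁₁₂ := thirdDifference_eq_zero h₁ h₁ h₂
  have h₁₂₂ := thirdDifference_eq_zero h₁ h₂ h₂
  rw [(h₁.add h₂).volume_eq, h₁.volume_eq, h₂.volume_eq, ← add_assoc (P₁ + P₂)]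
  simp only [thirdDifference, add_right_comm P₁ P₂ P₁] at hU₁₂ hsum₁₂ h₁₁₂ h₁₂₂ ⊢
  linarith
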